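/- Let G₁ be the simple graph on vertex set {1,…,8} with edge set E₁ = {{1,7},{1,2},{2,3},{3,4},{4,5},{5,6},{6,7},{7,8},{2,8},{2,5},{5,8}}, and let G₂ be the simple graph on the same vertex set with edge set E₂ = {{1,7},{1,2},{2,4},{4,5},{5,7},{7,8},{2,8},{2,5},{3,5},{3,6},{6,8}}. Then G₁ and G₂ have the same Tutte polynomial: Σ_{S ⊆ E₁} (x−1)^{r₁(E₁)−r₁(S)} (y−1)^{|S|−r₁(S)} = Σ_{S ⊆ E₂} (x−1)^{r₂(E₂)−r₂(S)} (y−1)^{|S|−r₂(S)} as polynomials in ℤ[x,y], where rᵢ(S) = 8 − (number of connected components of the spanning subgraph of Gᵢ with edge set S). -/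

import Mathlib

open Finset SimpleGraph MvPolynomial

/-- Edge set of the first Schwärzler graph `G₁` on vertices `{1,…,8}`,
encoded on `Fin 8` via `i ↦ i - 1`. -/
def E1 : Finset (Sym2 (Fin 8)) :=
  {s(0,6), s(0,1), s(1,2), s(2,3), s(3,4), s(4,5), s(5,6), s(6,7), s(1,7), s(1,4), s(4,7)}

/-- Edge set of the second Schwärzler graph `G₂` on vertices `{1,…,8}`,
encoded on `Fin 8` via `i ↦ i - 1`. -/
def E2 : Finset (Sym2 (Fin 8)) :=
  {s(0,6), s(0,1), s(1,3), s(3,4), s(4,6), s(6,7), s(1,7), s(1,4), s(2,4), s(2,5), s(5,7)}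

/-- The number of connected components of the spanning subgraph of the complete
graph on `Fin 8` with edge set `S`. -/
noncomputable def numComp (S : Finset (Sym2 (Fin 8))) : ℕ :=
  Nat.card (SimpleGraph.fromEdgeSet (↑S : Set (Sym2 (Fin 8)))).ConnectedComponent

/-- The (matroid) rank of an edge subset `S`: `8` minus the number of connected
components of the spanning subgraph `(V, S)`. -/
noncomputable def rk (S : Finset (Sym2 (Fin 8))) : ℕ := 8 - numComp S

instance (s : Set (Sym2 (Fin 8))) [DecidablePred (· ∈ s)] :
    DecidableRel (SimpleGraph.fromEdgeSet s).Adj := fun a b =>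
  decidable_of_iff (s(a, b) ∈ s ∧ a ≠ b) (SimpleGraph.fromEdgeSet_adj s).symm

/-- A labelling of the vertices whose fibres are the connected components of `G`. -/
def IsComponentLabelling {V : Type*} (G : SimpleGraph V) (f : V → ℕ) : Prop :=
  ∀ u v, f u = f v ↔ G.Reachable u v

/-- Give the class of `b` the label of the class of `a`. -/
def mergeLabels {V : Type*} (f : V → ℕ) (a b : V) : V → ℕ :=
  fun w => if f w = f b then f a else f w

/-- The number of labels used by a labelling of `Fin 8`. -/
def labelCount (f : Fin 8 → ℕ) : ℕ := (Finset.univ.image f).card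

/-- For every sublist of a list of edges, the number of components obtained by merging its edges
into the labelling `f` with `c` labels, paired with its length plus `k`. -/
def subsetProfile : List (Fin 8 × Fin 8) → (Fin 8 → ℕ) → ℕ → ℕ → List (ℕ × ℕ)
  | [], _, c, k => [(c, k)]
  | e :: es, f, c, k =>
    subsetProfile es f c k ++
      subsetProfile es (mergeLabels f e.1 e.2) (if f e.1 = f e.2 then c else c - 1) (k + 1)

/-- The labelling obtained by merging all edges of a list. -/
def mergeAll (es : List (Fin 8 × Fin 8)) (f : Fin 8 → ℕ) : Fin 8 → ℕ :=
  es.foldl (fun g e => mergeLabels g e.1 e.2) f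

/-- The finite set of unordered edges in a list of ordered pairs. -/
def edgesOf (es : List (Fin 8 × Fin 8)) : Finset (Sym2 (Fin 8)) :=
  (es.map fun e => s(e.1, e.2)).toFinset

theorem edgesOf_cons (e : Fin 8 × Fin 8) (es : List (Fin 8 × Fin 8)) :
    edgesOf (e :: es) = insert s(e.1, e.2) (edgesOf es) := by
  simp [edgesOf]

theorem IsComponentLabelling.insert_edge {V : Type*} {s : Set (Sym2 V)} {f : V → ℕ}
    (hf : IsComponentLabelling (SimpleGraph.fromEdgeSet s) f) (a b : V) :
    IsComponentLabelling (SimpleGraph.fromEdgeSet (insert s(a, b) s)) (mergeLabels f a b) := by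
  set G := SimpleGraph.fromEdgeSet s
  set H := SimpleGraph.fromEdgeSet (insert s(a, b) s)
  have hGH : G ≤ H := SimpleGraph.fromEdgeSet_mono (Set.subset_insert _ _)
  have hlift {u v : V} (h : f u = f v) : H.Reachable u v := ((hf u v).1 h).mono hGH
  have hab : H.Reachable a b := by
    by_cases h : a = b
    · exact h ▸ SimpleGraph.Reachable.refl _
    · exact SimpleGraph.Adj.reachable (by simp [H, h])
  intro u v
  constructor
  · intro h
    unfold mergeLabels at h
    split_ifs at h with hu hv hv
    · exact hlift (hu.trans hv.symm)
    · exact ((hlift hu).trans hab.symm).trans (hlift h)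
    · exact ((hlift h).trans hab).trans (hlift hv.symm)
    · exact hlift h
  · rintro ⟨p⟩
    induction p with
    | nil => rfl
    | @cons u v w h _ ih =>
      rw [← ih]
      obtain ⟨hmem, hne⟩ := (SimpleGraph.fromEdgeSet_adj _).1 h
      rcases hmem with hmem | hmem
      · rcases Sym2.eq_iff.1 hmem with ⟨rfl, rfl⟩ | ⟨rfl, rfl⟩ <;> simp [mergeLabels]
      · have huv : f u = f v :=
          (hf u v).2 (SimpleGraph.Adj.reachable ((SimpleGraph.fromEdgeSet_adj _).2 ⟨hmem, hne⟩))
        simp [mergeLabels, huv]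

theorem isComponentLabelling_empty :
    IsComponentLabelling
      (SimpleGraph.fromEdgeSet ((∅ : Finset (Sym2 (Fin 8))) : Set (Sym2 (Fin 8)))) Fin.val := by
  intro u v
  simp [Fin.ext_iff]

theorem numComp_eq_labelCount {S : Finset (Sym2 (Fin 8))} {f : Fin 8 → ℕ}
    (hf : IsComponentLabelling (SimpleGraph.fromEdgeSet (S : Set (Sym2 (Fin 8)))) f) :
    numComp S = labelCount f := by
  let g : (SimpleGraph.fromEdgeSet (S : Set (Sym2 (Fin 8)))).ConnectedComponent →
      Finset.univ.image f :=
    SimpleGraph.ConnectedComponent.lift (fun v => ⟨f v, by simp⟩)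
      (fun u v p _ => Subtype.ext ((hf u v).2 p.reachable))
  have hg : Function.Bijective g := by
    constructor
    · intro c d
      refine SimpleGraph.ConnectedComponent.ind₂ (fun u v h => ?_) c d
      exact SimpleGraph.ConnectedComponent.sound ((hf u v).1 (congrArg Subtype.val h))
    · rintro ⟨x, hx⟩
      obtain ⟨v, -, rfl⟩ := Finset.mem_image.1 hx
      exact ⟨SimpleGraph.connectedComponentMk _ v, rfl⟩
  rw [numComp, Nat.card_congr (Equiv.ofBijective g hg), Nat.card_eq_fintype_card,
    Fintype.card_coe, labelCount]

theorem labelCount_mergeLabels (f : Fin 8 → ℕ) (a b : Fin 8) :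
    labelCount (mergeLabels f a b) =
      if f a = f b then labelCount f else labelCount f - 1 := by
  split_ifs with h
  · congr 1
    funext w
    unfold mergeLabels
    split_ifs with hw
    · rw [h, hw]
    · rfl
  · have himage : Finset.univ.image (mergeLabels f a b) = (Finset.univ.image f).erase (f b) := by
      ext x
      simp only [Finset.mem_image, Finset.mem_univ, true_and, Finset.mem_erase, mergeLabels]
      constructor
      · rintro ⟨w, rfl⟩
        split_ifs with hw
        · exact ⟨h, a, rfl⟩
        · exact ⟨hw, w, rfl⟩
      · rintro ⟨hx, w, rfl⟩
        exact ⟨w, if_neg hx⟩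
    rw [labelCount, himage, Finset.card_erase_of_mem (by simp), labelCount]

theorem sum_powerset_eq_sum_subsetProfile {M : Type*} [AddCommMonoid M] (w : ℕ → ℕ → M)
    (es : List (Fin 8 × Fin 8)) (hes : (es.map fun e => s(e.1, e.2)).Nodup)
    (T : Finset (Sym2 (Fin 8))) (f : Fin 8 → ℕ) (k : ℕ)
    (hf : IsComponentLabelling (SimpleGraph.fromEdgeSet (T : Set (Sym2 (Fin 8)))) f) :
    ∑ S ∈ (edgesOf es).powerset, w (numComp (S ∪ T)) (S.card + k) =
      ((subsetProfile es f (labelCount f) k).map fun p => w p.1 p.2).sum := by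
  induction es generalizing T f k with
  | nil => simp [edgesOf, subsetProfile, numComp_eq_labelCount hf]
  | cons e es ih =>
    rw [List.map_cons, List.nodup_cons] at hes
    have he : s(e.1, e.2) ∉ edgesOf es := by simpa [edgesOf] using hes.1
    rw [edgesOf_cons, Finset.sum_powerset_insert he, subsetProfile, ← labelCount_mergeLabels,
      List.map_append, List.sum_append, ← ih hes.2 T f k hf,
      ← ih hes.2 (insert s(e.1, e.2) T) _ (k + 1)
        (by simpa only [Finset.coe_insert] using hf.insert_edge e.1 e.2)]
    congr 1
    refine Finset.sum_congr rfl fun S hS => ?_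
    have heS : s(e.1, e.2) ∉ S := fun h => he (Finset.mem_powerset.1 hS h)
    rw [Finset.card_insert_of_notMem heS, Finset.insert_union, Finset.union_insert,
      Nat.add_right_comm, Nat.add_assoc]

theorem numComp_edgesOf_union (es : List (Fin 8 × Fin 8)) (T : Finset (Sym2 (Fin 8)))
    (f : Fin 8 → ℕ)
    (hf : IsComponentLabelling (SimpleGraph.fromEdgeSet (T : Set (Sym2 (Fin 8)))) f) :
    numComp (edgesOf es ∪ T) = labelCount (mergeAll es f) := by
  induction es generalizing T f with
  | nil => simpa [edgesOf, mergeAll] using numComp_eq_labelCount hf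
  | cons e es ih =>
    rw [edgesOf_cons, Finset.insert_union, ← Finset.union_insert]
    exact ih _ _ (by simpa only [Finset.coe_insert] using hf.insert_edge e.1 e.2)

/-- The edges of `G₁` as ordered pairs. -/
def edgeList1 : List (Fin 8 × Fin 8) :=
  [(0,6), (0,1), (1,2), (2,3), (3,4), (4,5), (5,6), (6,7), (1,7), (1,4), (4,7)]

/-- The edges of `G₂` as ordered pairs. -/
def edgeList2 : List (Fin 8 × Fin 8) :=
  [(0,6), (0,1), (1,3), (3,4), (4,6), (6,7), (1,7), (1,4), (2,4), (2,5), (5,7)]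

theorem E1_eq_edgesOf : E1 = edgesOf edgeList1 := by
  simp [E1, edgesOf, edgeList1]

theorem E2_eq_edgesOf : E2 = edgesOf edgeList2 := by
  simp [E2, edgesOf, edgeList2]

theorem numComp_E1 : numComp E1 = 1 := by
  have h := numComp_edgesOf_union edgeList1 ∅ _ isComponentLabelling_empty
  rw [Finset.union_empty, ← E1_eq_edgesOf] at h
  exact h.trans (by decide +kernel)

theorem numComp_E2 : numComp E2 = 1 := by
  have h := numComp_edgesOf_union edgeList2 ∅ _ isComponentLabelling_empty
  rw [Finset.union_empty, ← E2_eq_edgesOf] at h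
  exact h.trans (by decide +kernel)

theorem length_subsetProfile (es : List (Fin 8 × Fin 8)) (f : Fin 8 → ℕ) (c k : ℕ) :
    (subsetProfile es f c k).length = 2 ^ es.length := by
  induction es generalizing f c k with
  | nil => rfl
  | cons e es ih => simp [subsetProfile, ih, pow_succ, mul_two]

theorem eq_of_sum_mul_pow_eq {B : ℕ} (n : ℕ) {c d : ℕ → ℕ} (hc : ∀ i, c i < B)
    (hd : ∀ i, d i < B)
    (h : ∑ i ∈ Finset.range n, c i * B ^ i = ∑ i ∈ Finset.range n, d i * B ^ i) :
    ∀ i < n, c i = d i := by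
  induction n generalizing c d with
  | zero => simp
  | succ n ih =>
    simp only [Finset.sum_range_succ', pow_succ, pow_zero, mul_one, ← mul_assoc,
      ← Finset.sum_mul] at h
    have h0 : c 0 = d 0 := by
      have hmod := congrArg (· % B) h
      simpa [Nat.add_mod, Nat.mod_eq_of_lt (hc 0), Nat.mod_eq_of_lt (hd 0)] using hmod
    rw [h0, Nat.add_right_cancel_iff] at h
    have hsum := Nat.eq_of_mul_eq_mul_right ((Nat.zero_le _).trans_lt (hc 0)) h
    rintro (_ | i) hi
    · exact h0
    · exact ih (fun i => hc (i + 1)) (fun i => hd (i + 1)) hsum i (by omega)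

theorem List.perm_of_sum_map_pow_eq {B : ℕ} {l m : List ℕ} (hl : l.length < B)
    (hm : m.length < B) (h : (l.map (B ^ ·)).sum = (m.map (B ^ ·)).sum) : l.Perm m := by
  have hlt (i : ℕ) (hi : i ∈ l ++ m) : i < (l ++ m).sum + 1 :=
    Nat.lt_succ_of_le (List.le_sum_of_mem hi)
  have hsum (k : List ℕ) (hk : k ⊆ l ++ m) : (k.map (B ^ ·)).sum =
      ∑ i ∈ Finset.range ((l ++ m).sum + 1), k.count i * B ^ i := by
    rw [Finset.sum_list_map_count]
    refine Finset.sum_subset (fun i hi => ?_) (fun i _ hi => ?_)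
    · exact Finset.mem_range.2 (hlt i (hk (List.mem_toFinset.1 hi)))
    · rw [List.count_eq_zero_of_not_mem (fun hik => hi (List.mem_toFinset.2 hik)), zero_smul]
  rw [hsum l (List.subset_append_left _ _), hsum m (List.subset_append_right _ _)] at h
  refine List.perm_iff_count.2 fun i => ?_
  by_cases hi : i ∈ l ++ m
  · exact eq_of_sum_mul_pow_eq _ (fun i => List.count_le_length.trans_lt hl)
      (fun i => List.count_le_length.trans_lt hm) h i (hlt i hi)
  · rw [List.mem_append, not_or] at hi
    rw [List.count_eq_zero_of_not_mem hi.1, List.count_eq_zero_of_not_mem hi.2]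

theorem subsetProfile_perm :
    (subsetProfile edgeList1 Fin.val 8 0).Perm (subsetProfile edgeList2 Fin.val 8 0) := by
  have hinj : Function.Injective (Function.uncurry Nat.pair) := Nat.pairEquiv.injective
  refine (List.map_perm_map_iff hinj).1
    (List.perm_of_sum_map_pow_eq (B := 4096) ?_ ?_ ?_)
  · simp [length_subsetProfile, edgeList1]
  · simp [length_subsetProfile, edgeList2]
  · decide +kernel

/-- The two Schwärzler graphs `G₁` and `G₂` have the same Tutte polynomial
(in `ℤ[x,y]`, with `x = X 0`, `y = X 1`). -/
theorem tutte_G1_eq_tutte_G2 :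
    (∑ S ∈ E1.powerset,
        (X 0 - 1 : MvPolynomial (Fin 2) ℤ) ^ (rk E1 - rk S) * (X 1 - 1) ^ (S.card - rk S)) =
    (∑ S ∈ E2.powerset,
        (X 0 - 1 : MvPolynomial (Fin 2) ℤ) ^ (rk E2 - rk S) * (X 1 - 1) ^ (S.card - rk S)) := by
  have hrk : rk E1 = rk E2 := by rw [rk, rk, numComp_E1, numComp_E2]
  let w : ℕ → ℕ → MvPolynomial (Fin 2) ℤ := fun c k =>
    (X 0 - 1) ^ (rk E2 - (8 - c)) * (X 1 - 1) ^ (k - (8 - c))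
  have hcount : labelCount Fin.val = 8 := by decide
  have h₁ := sum_powerset_eq_sum_subsetProfile w edgeList1 (by decide) ∅ _ 0
    isComponentLabelling_empty
  have h₂ := sum_powerset_eq_sum_subsetProfile w edgeList2 (by decide) ∅ _ 0
    isComponentLabelling_empty
  simp only [Finset.union_empty, Nat.add_zero, hcount, ← E1_eq_edgesOf, ← E2_eq_edgesOf] at h₁ h₂
  rw [hrk]
  exact h₁.trans ((subsetProfile_perm.map _).sum_eq.trans h₂.symm)
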